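/- Let b₀, …, bₙ : ℤ → Matrix (Fin r) (Fin r) R, let φ : ℤ → Matrix (Fin r) (Fin m) R and ψ : ℤ → Matrix (Fin m) (Fin r) R have support bounded below, and let M : ℤ → Matrix (Fin r) (Fin m') R, N : ℤ → Matrix (Fin m') (Fin r) R be arbitrary. Set 𝕋 = Σ_{i=0}^{n} M_{b_i}∘Δ^i + M_φ∘J∘M_ψ and X = M_M∘J∘M_N on V_r, and define X·φ := M·J(N·φ), X*·ψ := -Λ(J(ψ·M))·N, 𝕃·M := Σ_{i=0}^{n} b_i·Δ^i(M) + φ·J(ψ·M), and 𝕃*·N := Σ_{i=0}^{n} (-1)^i Δ^i(Λ⁻ⁱ(N·b_i)) - Λ(J(N·φ))·ψ. Then there exist c₀, …, c_{n-1} : ℤ → Matrix (Fin r) (Fin r) R such that, as operators on V_r, X∘𝕋 - 𝕋∘X = M_M∘J∘M_{𝕃*·N} - M_{𝕃·M}∘J∘M_N + M_{X·φ}∘J∘M_ψ - M_φ∘J∘M_{X*·ψ} + Σ_{i=0}^{n-1} M_{c_i}∘Δ^i. (This is the identity [X, 𝕃_Δ]₋ = [MΔ⁻¹𝕃_Δ*(N)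 - 𝕃_Δ(M)Δ⁻¹N] + [X(φ)Δ⁻¹ψ - φΔ⁻¹X*(ψ)] for X = MΔ⁻¹N.) -/

import Mathlib

open Finset

/-- A sequence with values in `A` has support bounded below. -/
def SuppBddBelow {A : Type*} [Zero A] (f : ℤ → A) : Prop :=
  ∃ M : ℤ, ∀ n : ℤ, n < M → f n = 0

/-- The shift operator `(Λ f)(n) = f(n+1)` (applied entrywise). -/
def shiftL {A : Type*} (f : ℤ → A) : ℤ → A := fun n => f (n + 1)

/-- The inverse shift operator `(Λ⁻¹ f)(n) = f(n-1)` (applied entrywise). -/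
def shiftLinv {A : Type*} (f : ℤ → A) : ℤ → A := fun n => f (n - 1)

/-- The difference operator `(Δ f)(n) = f(n+1) - f(n)` (applied entrywise). -/
def Del {A : Type*} [AddCommGroup A] (f : ℤ → A) : ℤ → A := fun n => f (n + 1) - f n

/-- The summation operator `(J f)(n) = ∑_{m < n} f(m)` (a finite sum when the
support of `f` is bounded below, realized via `finsum`; applied entrywise). -/
noncomputable def Jop {A : Type*} [AddCommMonoid A] (f : ℤ → A) : ℤ → A :=
  fun n => ∑ᶠ (m : ℤ) (_ : m < n), f m

variable {R : Type*} [CommRing R]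

/-- The operator `𝕋 = Σ_{i=0}^{n} M_{b_i}∘Δⁱ + M_φ∘J∘M_ψ` acting on `V_r`. -/
noncomputable def TTop {r m : ℕ} (n : ℕ) (b : ℕ → ℤ → Matrix (Fin r) (Fin r) R)
    (φ : ℤ → Matrix (Fin r) (Fin m) R) (ψ : ℤ → Matrix (Fin m) (Fin r) R)
    (g : ℤ → Fin r → R) : ℤ → Fin r → R :=
  fun k => (∑ i ∈ Finset.range (n + 1), (b i k).mulVec (Del^[i] g k))
    + (φ k).mulVec (Jop (fun j => (ψ j).mulVec (g j)) k)

/-- The operator `X = M_M∘J∘M_N` acting on `V_r`. -/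
noncomputable def Xop {r m' : ℕ} (M : ℤ → Matrix (Fin r) (Fin m') R)
    (N : ℤ → Matrix (Fin m') (Fin r) R) (g : ℤ → Fin r → R) : ℤ → Fin r → R :=
  fun k => (M k).mulVec (Jop (fun j => (N j).mulVec (g j)) k)

/-- The action `𝕃·F = Σ_{i=0}^{n} b_i·Δⁱ(F) + φ·J(ψ·F)` on matrix-valued sequences. -/
noncomputable def LLMat {r m p : ℕ} (n : ℕ) (b : ℕ → ℤ → Matrix (Fin r) (Fin r) R)
    (φ : ℤ → Matrix (Fin r) (Fin m) R) (ψ : ℤ → Matrix (Fin m) (Fin r) R)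
    (F : ℤ → Matrix (Fin r) (Fin p) R) : ℤ → Matrix (Fin r) (Fin p) R :=
  fun k => (∑ i ∈ Finset.range (n + 1), b i k * Del^[i] F k)
    + φ k * Jop (fun j => ψ j * F j) k

/-- The adjoint action `𝕃*·G = Σ_{i=0}^{n} (-1)ⁱ Δⁱ(Λ⁻ⁱ(G·b_i)) - Λ(J(G·φ))·ψ`. -/
noncomputable def LLStarMat {r m p : ℕ} (n : ℕ) (b : ℕ → ℤ → Matrix (Fin r) (Fin r) R)
    (φ : ℤ → Matrix (Fin r) (Fin m) R) (ψ : ℤ → Matrix (Fin m) (Fin r) R)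
    (G : ℤ → Matrix (Fin p) (Fin r) R) : ℤ → Matrix (Fin p) (Fin r) R :=
  fun k => (∑ i ∈ Finset.range (n + 1),
      ((-1 : R) ^ i) • Del^[i] (shiftLinv^[i] (fun j => G j * b i j)) k)
    - shiftL (Jop (fun j => G j * φ j)) k * ψ k

namespace SuppBddBelow

variable {A B : Type*}

theorem of_imp [Zero A] [Zero B] {f : ℤ → A} {h : ℤ → B} (hf : SuppBddBelow f)
    (H : ∀ k, f k = 0 → h k = 0) : SuppBddBelow h :=
  hf.imp fun _ hM k hk => H k (hM k hk)

theorem of_imp₂ {C : Type*} [Zero A] [Zero B] [Zero C] {f : ℤ → A} {h : ℤ → B} {w : ℤ → C}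
    (hf : SuppBddBelow f) (hh : SuppBddBelow h)
    (H : ∀ k, f k = 0 → h k = 0 → w k = 0) : SuppBddBelow w := by
  obtain ⟨a, ha⟩ := hf
  obtain ⟨b, hb⟩ := hh
  exact ⟨min a b, fun k hk => H k (ha k (by omega)) (hb k (by omega))⟩

theorem shiftL [Zero A] {f : ℤ → A} (hf : SuppBddBelow f) : SuppBddBelow (shiftL f) := by
  obtain ⟨a, ha⟩ := hf
  exact ⟨a - 1, fun k hk => ha _ (by omega)⟩

theorem Del [AddCommGroup A] {f : ℤ → A} (hf : SuppBddBelow f) : SuppBddBelow (Del f) :=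
  hf.shiftL.of_imp₂ hf fun k h₁ h₂ => by
    simp only [_root_.shiftL] at h₁
    simp [_root_.Del, h₁, h₂]

theorem Del_iterate [AddCommGroup A] {f : ℤ → A} (hf : SuppBddBelow f) (i : ℕ) :
    SuppBddBelow (_root_.Del^[i] f) := by
  induction i with
  | zero => exact hf
  | succ i ih =>
    rw [Function.iterate_succ_apply']
    exact ih.Del

theorem sum [AddCommMonoid A] {ι : Type*} {s : Finset ι} {f : ι → ℤ → A}
    (hf : ∀ i ∈ s, SuppBddBelow (f i)) : SuppBddBelow fun k => ∑ i ∈ s, f i k := by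
  classical
  induction s using Finset.induction_on with
  | empty => exact ⟨0, fun k _ => by simp⟩
  | insert a s ha ih =>
    refine (hf a (by simp)).of_imp₂ (ih fun i hi => hf i (by simp [hi])) fun k h₁ h₂ => ?_
    rw [Finset.sum_insert ha, h₁, h₂, add_zero]

theorem Jop [AddCommMonoid A] {f : ℤ → A} (hf : SuppBddBelow f) : SuppBddBelow (Jop f) := by
  obtain ⟨a, ha⟩ := hf
  refine ⟨a, fun k hk => ?_⟩
  change ∑ᶠ j ∈ Set.Iio k, f j = 0
  exact finsum_mem_eq_zero_of_forall_eq_zero fun j hj => ha j (lt_trans hj hk)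

theorem mulVec {p q : ℕ} (F : ℤ → Matrix (Fin p) (Fin q) R) {g : ℤ → Fin q → R}
    (hg : SuppBddBelow g) : SuppBddBelow fun k => (F k).mulVec (g k) :=
  hg.of_imp fun k h => by simp [h]

end SuppBddBelow

section Summation

variable {A : Type*} [AddCommGroup A]

theorem Jop_succ {f : ℤ → A} (hf : SuppBddBelow f) (k : ℤ) : Jop f (k + 1) = Jop f k + f k := by
  obtain ⟨a, ha⟩ := hf
  have hfin : (Set.Iio k ∩ Function.support f).Finite :=
    (Set.finite_Ico a k).subset fun j ⟨hj, hj'⟩ =>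
      ⟨not_lt.1 fun h => hj' (ha j h), hj⟩
  have hset : {j : ℤ | j < k + 1} = insert k (Set.Iio k) := by
    ext j
    simp only [Set.mem_ofPred_eq, Set.mem_insert_iff, Set.mem_Iio]
    omega
  change ∑ᶠ j ∈ {j : ℤ | j < k + 1}, f j = ∑ᶠ j ∈ Set.Iio k, f j + f k
  rw [hset, finsum_mem_insert' f (by simp) hfin, add_comm]

theorem eq_zero_of_succ_eq {w : ℤ → A} (hw : SuppBddBelow w) (h : ∀ k, w (k + 1) = w k) (k : ℤ) :
    w k = 0 := by
  obtain ⟨a, ha⟩ := hw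
  have hconst : ∀ j : ℤ, w j = w (a - 1) := fun j => by
    induction j using Int.inductionOn' (b := a - 1) with
    | zero => rfl
    | succ j _ ih => rw [h, ih]
    | pred j _ ih =>
      rw [← ih, ← h (j - 1), sub_add_cancel]
  rw [hconst, ha _ (by omega)]

theorem Jop_eq_of_succ {f u : ℤ → A} (hf : SuppBddBelow f) (hu : SuppBddBelow u)
    (h : ∀ k, u (k + 1) = u k + f k) (k : ℤ) : Jop f k = u k := by
  rw [← sub_eq_zero]
  refine eq_zero_of_succ_eq (w := fun k => Jop f k - u k)
    (hf.Jop.of_imp₂ hu fun k h₁ h₂ => by simp [h₁, h₂]) (fun k => ?_) k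
  simp only [Jop_succ hf, h]
  abel

theorem Jop_add {f h : ℤ → A} (hf : SuppBddBelow f) (hh : SuppBddBelow h) (k : ℤ) :
    Jop (fun j => f j + h j) k = Jop f k + Jop h k := by
  refine Jop_eq_of_succ (u := fun k => Jop f k + Jop h k)
    (hf.of_imp₂ hh fun k h₁ h₂ => by simp [h₁, h₂])
    (hf.Jop.of_imp₂ hh.Jop fun k h₁ h₂ => by simp [h₁, h₂]) (fun k => ?_) k
  simp only [Jop_succ hf, Jop_succ hh]
  abel

theorem Jop_neg {f : ℤ → A} (hf : SuppBddBelow f) (k : ℤ) :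
    Jop (fun j => -f j) k = -Jop f k := by
  refine Jop_eq_of_succ (u := fun k => -Jop f k)
    (hf.of_imp fun k h₁ => by simp [h₁])
    (hf.Jop.of_imp fun k h₁ => by simp [h₁]) (fun k => ?_) k
  simp only [Jop_succ hf]
  abel

theorem Jop_sum {ι : Type*} {s : Finset ι} {f : ι → ℤ → A}
    (hf : ∀ i ∈ s, SuppBddBelow (f i)) (k : ℤ) :
    Jop (fun j => ∑ i ∈ s, f i j) k = ∑ i ∈ s, Jop (f i) k := by
  refine Jop_eq_of_succ (u := fun k => ∑ i ∈ s, Jop (f i) k) (SuppBddBelow.sum hf)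
    (SuppBddBelow.sum fun i hi => (hf i hi).Jop) (fun k => ?_) k
  rw [← Finset.sum_add_distrib]
  exact Finset.sum_congr rfl fun i hi => Jop_succ (hf i hi) k

theorem Del_iterate_add (i : ℕ) (f h : ℤ → A) :
    Del^[i] (fun k => f k + h k) = fun k => Del^[i] f k + Del^[i] h k := by
  induction i generalizing f h with
  | zero => rfl
  | succ i ih =>
    simp only [Function.iterate_succ_apply]
    rw [← ih]
    congr 1
    funext k
    simp only [Del]
    abel

theorem Del_iterate_neg (i : ℕ) (f : ℤ → A) : Del^[i] (-f) = -Del^[i] f := by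
  have h : Function.Semiconj (Neg.neg : (ℤ → A) → ℤ → A) Del Del := fun f => by
    funext k
    simp only [Del, Pi.neg_apply]
    abel
  exact (h.iterate_right i f).symm

theorem shiftLinv_iterate_neg (i : ℕ) (f : ℤ → A) : shiftLinv^[i] (-f) = -shiftLinv^[i] f := by
  have h : Function.Semiconj (Neg.neg : (ℤ → A) → ℤ → A) shiftLinv shiftLinv := fun _ => rfl
  exact (h.iterate_right i f).symm

theorem shiftLinv_iterate_Del (i : ℕ) (f : ℤ → A) :
    shiftLinv^[i] (Del f) = Del (shiftLinv^[i] f) := by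
  have h : Function.Commute (shiftLinv : (ℤ → A) → ℤ → A) Del := fun f => by
    funext k
    simp only [Del, shiftLinv]
    congr 2
    ring
  exact h.iterate_left i f

end Summation

section Products

variable {p q r : ℕ}

/-- Summation by parts for a product of two sums. -/
theorem Jop_mulVec_Jop {f : ℤ → Matrix (Fin p) (Fin q) R} {h : ℤ → Fin q → R}
    (hf : SuppBddBelow f) (hh : SuppBddBelow h) (k : ℤ) :
    Jop (fun j => (f j).mulVec (Jop h j)) k
      = (Jop f k).mulVec (Jop h k) - Jop (fun j => (shiftL (Jop f) j).mulVec (h j)) k := by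
  have hs : SuppBddBelow fun j => (shiftL (Jop f) j).mulVec (h j) := hh.mulVec _
  refine Jop_eq_of_succ (u := fun k => (Jop f k).mulVec (Jop h k)
      - Jop (fun j => (shiftL (Jop f) j).mulVec (h j)) k) (hh.Jop.mulVec f)
    ((hh.Jop.mulVec _).of_imp₂ hs.Jop fun k h₁ h₂ => by rw [h₁, h₂, sub_zero]) (fun k => ?_) k
  simp only [Jop_succ hs]
  simp only [shiftL, Jop_succ hf, Jop_succ hh, Matrix.mulVec_add, Matrix.add_mulVec]
  abel

theorem Jop_mulVec_Del (f : ℤ → Matrix (Fin p) (Fin q) R) {h : ℤ → Fin q → R}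
    (hh : SuppBddBelow h) (k : ℤ) :
    Jop (fun j => (f j).mulVec (Del h j)) k
      = (shiftLinv f k).mulVec (h k) + Jop (fun j => (-Del (shiftLinv f) j).mulVec (h j)) k := by
  have hs : SuppBddBelow fun j => (-Del (shiftLinv f) j).mulVec (h j) := hh.mulVec _
  refine Jop_eq_of_succ (u := fun k => (shiftLinv f k).mulVec (h k)
      + Jop (fun j => (-Del (shiftLinv f) j).mulVec (h j)) k) (hh.Del.mulVec f)
    ((hh.mulVec _).of_imp₂ hs.Jop fun k h₁ h₂ => by rw [h₁, h₂, add_zero]) (fun k => ?_) k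
  simp only [Jop_succ hs]
  simp only [shiftLinv, Del, Matrix.mulVec_sub, Matrix.sub_mulVec, Matrix.neg_mulVec,
    add_sub_cancel_right]
  abel

/-- `T` acts on sequences with support bounded below as a local difference operator
of order strictly less than `n`. -/
def IsLocalLT (n : ℕ) (T : (ℤ → Fin r → R) → ℤ → Fin p → R) : Prop :=
  ∃ c : ℕ → ℤ → Matrix (Fin p) (Fin r) R, ∀ g : ℤ → Fin r → R, SuppBddBelow g → ∀ x : ℤ,
    T g x = ∑ i ∈ Finset.range n, (c i x).mulVec (Del^[i] g x)

namespace IsLocalLT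

theorem congr {n : ℕ} {T S : (ℤ → Fin r → R) → ℤ → Fin p → R} (hT : IsLocalLT n T)
    (h : ∀ g, SuppBddBelow g → ∀ x, S g x = T g x) : IsLocalLT n S := by
  obtain ⟨c, hc⟩ := hT
  exact ⟨c, fun g hg x => by rw [h g hg, hc g hg]⟩

theorem mono {n k : ℕ} (hnk : n ≤ k) {T : (ℤ → Fin r → R) → ℤ → Fin p → R}
    (hT : IsLocalLT n T) : IsLocalLT k T := by
  obtain ⟨c, hc⟩ := hT
  refine ⟨fun i => if i < n then c i else 0, fun g hg x => ?_⟩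
  rw [hc g hg]
  refine Finset.sum_subset_zero_on_sdiff (by simpa using hnk) (fun i hi => ?_) fun i hi => ?_
  · rw [Finset.mem_sdiff, Finset.mem_range, Finset.mem_range] at hi
    simp [hi.2]
  · simp only [if_pos (Finset.mem_range.1 hi)]

theorem zero (n : ℕ) : IsLocalLT n fun (_ : ℤ → Fin r → R) (_ : ℤ) => (0 : Fin p → R) :=
  ⟨0, fun g _ x => by simp⟩

theorem add {n : ℕ} {T S : (ℤ → Fin r → R) → ℤ → Fin p → R} (hT : IsLocalLT n T)
    (hS : IsLocalLT n S) : IsLocalLT n fun g x => T g x + S g x := by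
  obtain ⟨c, hc⟩ := hT
  obtain ⟨d, hd⟩ := hS
  refine ⟨fun i x => c i x + d i x, fun g hg x => ?_⟩
  simp only [hc g hg, hd g hg, Matrix.add_mulVec, Finset.sum_add_distrib]

theorem mulVec {n : ℕ} (F : ℤ → Matrix (Fin q) (Fin p) R)
    {T : (ℤ → Fin r → R) → ℤ → Fin p → R} (hT : IsLocalLT n T) :
    IsLocalLT n fun g x => (F x).mulVec (T g x) := by
  obtain ⟨c, hc⟩ := hT
  refine ⟨fun i x => F x * c i x, fun g hg x => ?_⟩
  simp only [hc g hg, Matrix.mulVec_sum, Matrix.mulVec_mulVec]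

theorem neg {n : ℕ} {T : (ℤ → Fin r → R) → ℤ → Fin p → R} (hT : IsLocalLT n T) :
    IsLocalLT n fun g x => -T g x :=
  (hT.mulVec fun _ => -1).congr fun g _ x => by simp [Matrix.neg_mulVec]

theorem sum {n : ℕ} {ι : Type*} {s : Finset ι} {T : ι → (ℤ → Fin r → R) → ℤ → Fin p → R}
    (hT : ∀ i ∈ s, IsLocalLT n (T i)) : IsLocalLT n fun g x => ∑ i ∈ s, T i g x := by
  classical
  induction s using Finset.induction_on with
  | empty => exact (zero n).congr fun g _ x => by simp
  | insert a s ha ih =>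
    exact ((hT a (by simp)).add (ih fun i hi => hT i (by simp [hi]))).congr
      fun g _ x => Finset.sum_insert ha

theorem comp_Del {n : ℕ} {T : (ℤ → Fin r → R) → ℤ → Fin p → R} (hT : IsLocalLT n T) :
    IsLocalLT (n + 1) fun g => T (Del g) := by
  obtain ⟨c, hc⟩ := hT
  refine ⟨fun i => if i = 0 then 0 else c (i - 1), fun g hg x => ?_⟩
  simp [hc _ hg.Del, Finset.sum_range_succ']

theorem mulVec_Del_iterate (i : ℕ) (F : ℤ → Matrix (Fin p) (Fin r) R) :
    IsLocalLT (i + 1) fun g x => (F x).mulVec (Del^[i] g x) := by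
  refine ⟨fun j => if j = i then F else 0, fun g _ x => ?_⟩
  rw [Finset.sum_eq_single i] <;> simp +contextual

end IsLocalLT

theorem Del_mulVec (F : ℤ → Matrix (Fin p) (Fin q) R) (g : ℤ → Fin q → R) :
    Del (fun k => (F k).mulVec (g k))
      = fun k => (Del F k).mulVec (g k) + (shiftL F k).mulVec (Del g k) := by
  funext k
  simp only [Del, shiftL, Matrix.sub_mulVec, Matrix.mulVec_sub]
  abel

theorem isLocalLT_Del_iterate_mulVec (i : ℕ) (F : ℤ → Matrix (Fin p) (Fin r) R) :
    IsLocalLT (i + 1) fun g => Del^[i] fun k => (F k).mulVec (g k) := by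
  induction i generalizing F with
  | zero => exact IsLocalLT.mulVec_Del_iterate 0 F
  | succ i ih =>
    refine (((ih (Del F)).mono (Nat.le_succ _)).add (ih (shiftL F)).comp_Del).congr
      fun g _ x => ?_
    rw [Function.iterate_succ_apply, Del_mulVec, Del_iterate_add]

theorem Del_Jop {f : ℤ → Fin q → R} (hf : SuppBddBelow f) : Del (Jop f) = f := by
  funext k
  rw [Del, Jop_succ hf, add_sub_cancel_left]

/-- `Δⁱ ∘ M_F ∘ J ∘ M_N` and `M_{Δⁱ F} ∘ J ∘ M_N` differ by a local operator of order `< i`. -/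
theorem isLocalLT_Del_iterate_mulVec_Jop (i : ℕ) (F : ℤ → Matrix (Fin p) (Fin q) R)
    (N : ℤ → Matrix (Fin q) (Fin r) R) :
    IsLocalLT i fun g x =>
      Del^[i] (fun k => (F k).mulVec (Jop (fun j => (N j).mulVec (g j)) k)) x
        - (Del^[i] F x).mulVec (Jop (fun j => (N j).mulVec (g j)) x) := by
  induction i generalizing F with
  | zero => exact (IsLocalLT.zero 0).congr fun g _ x => by simp
  | succ i ih =>
    refine (((ih (Del F)).mono (Nat.le_succ _)).add
      (isLocalLT_Del_iterate_mulVec i fun k => shiftL F k * N k)).congr fun g hg x => ?_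
    simp only [Function.iterate_succ_apply]
    rw [Del_mulVec, Del_iterate_add, Del_Jop (hg.mulVec N)]
    simp only [Matrix.mulVec_mulVec]
    abel

/-- `J ∘ M_F ∘ Δⁱ` and `J ∘ M_{(-1)ⁱ Δⁱ Λ⁻ⁱ F}` differ by a local operator of order `< i`. -/
theorem isLocalLT_Jop_mulVec_Del_iterate (i : ℕ) (F : ℤ → Matrix (Fin p) (Fin r) R) :
    IsLocalLT i fun g x =>
      Jop (fun j => (F j).mulVec (Del^[i] g j)) x
        - Jop (fun j => (((-1 : R) ^ i) • Del^[i] (shiftLinv^[i] F) j).mulVec (g j)) x := by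
  induction i generalizing F with
  | zero => exact (IsLocalLT.zero 0).congr fun g _ x => by simp
  | succ i ih =>
    refine ((ih fun j => -Del (shiftLinv F) j).mono (Nat.le_succ _) |>.add
      (IsLocalLT.mulVec_Del_iterate i (shiftLinv F))).congr fun g hg x => ?_
    have key : ∀ j, ((-1 : R) ^ (i + 1)) • Del^[i + 1] (shiftLinv^[i + 1] F) j
        = ((-1 : R) ^ i) • Del^[i] (shiftLinv^[i] fun j => -Del (shiftLinv F) j) j := by
      intro j
      change _ = _ • Del^[i] (shiftLinv^[i] (-Del (shiftLinv F))) j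
      rw [shiftLinv_iterate_neg, Del_iterate_neg, shiftLinv_iterate_Del,
        Function.iterate_succ_apply, Function.iterate_succ_apply, pow_succ]
      simp
    simp only [key]
    simp only [Function.iterate_succ_apply' Del]
    rw [Jop_mulVec_Del F (hg.Del_iterate i)]
    abel

end Products

/-- with `X = M_M∘J∘M_N`, `X·φ = M·J(N·φ)` and `X*·ψ = -Λ(J(ψ·M))·N`,
there exist `c₀,…,c_{n-1}` such that, as operators on `V_r`,
`X∘𝕋 - 𝕋∘X = M_M∘J∘M_{𝕃*·N} - M_{𝕃·M}∘J∘M_N + M_{X·φ}∘J∘M_ψ - M_φ∘J∘M_{X*·ψ}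
  + Σ_{i=0}^{n-1} M_{c_i}∘Δⁱ`. -/
theorem stmt9 {r m m' n : ℕ} (b : ℕ → ℤ → Matrix (Fin r) (Fin r) R)
    (φ : ℤ → Matrix (Fin r) (Fin m) R) (ψ : ℤ → Matrix (Fin m) (Fin r) R)
    (hφ : SuppBddBelow φ) (hψ : SuppBddBelow ψ)
    (M : ℤ → Matrix (Fin r) (Fin m') R) (N : ℤ → Matrix (Fin m') (Fin r) R) :
    ∃ c : ℕ → ℤ → Matrix (Fin r) (Fin r) R,
      ∀ g : ℤ → Fin r → R, SuppBddBelow g → ∀ x : ℤ,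
        Xop M N (TTop n b φ ψ g) x - TTop n b φ ψ (Xop M N g) x
          = (M x).mulVec (Jop (fun y => (LLStarMat n b φ ψ N y).mulVec (g y)) x)
            - (LLMat n b φ ψ M x).mulVec (Jop (fun y => (N y).mulVec (g y)) x)
            + ((fun y => M y * Jop (fun z => N z * φ z) y) x).mulVec
                (Jop (fun y => (ψ y).mulVec (g y)) x)
            - (φ x).mulVec
                (Jop (fun y =>
                  ((fun z => -(shiftL (Jop (fun w => ψ w * M w)) z * N z)) y).mulVec (g y)) x)
            + ∑ i ∈ Finset.range n, (c i x).mulVec (Del^[i] g x) := by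
  have hlocal : IsLocalLT n fun (g : ℤ → Fin r → R) x =>
      (∑ i ∈ Finset.range (n + 1), (M x).mulVec
        (Jop (fun j => (N j * b i j).mulVec (Del^[i] g j)) x
          - Jop (fun j => (((-1 : R) ^ i) •
              Del^[i] (shiftLinv^[i] fun j => N j * b i j) j).mulVec (g j)) x))
      + -∑ i ∈ Finset.range (n + 1), (b i x).mulVec
        (Del^[i] (fun k => (M k).mulVec (Jop (fun j => (N j).mulVec (g j)) k)) x
          - (Del^[i] M x).mulVec (Jop (fun j => (N j).mulVec (g j)) x)) := by
    have hle : ∀ i ∈ Finset.range (n + 1), i ≤ n := fun i hi =>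
      Nat.lt_succ_iff.1 (Finset.mem_range.1 hi)
    exact (IsLocalLT.sum fun i hi =>
        ((isLocalLT_Jop_mulVec_Del_iterate i _).mono (hle i hi)).mulVec M).add
      (IsLocalLT.sum fun i hi =>
        ((isLocalLT_Del_iterate_mulVec_Jop i M N).mono (hle i hi)).mulVec (b i)).neg
  obtain ⟨c, hc⟩ := hlocal
  refine ⟨c, fun g hg x => ?_⟩
  rw [← hc g hg x]
  have hNφ : SuppBddBelow fun j => N j * φ j := hφ.of_imp fun k h => by simp [h]
  have hψM : SuppBddBelow fun j => ψ j * M j := hψ.of_imp fun k h => by simp [h]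
  have hψg := hg.mulVec ψ
  have hNg := hg.mulVec N
  have hXT : Jop (fun j => (N j).mulVec (TTop n b φ ψ g j)) x
      = (∑ i ∈ Finset.range (n + 1), Jop (fun j => (N j * b i j).mulVec (Del^[i] g j)) x)
        + ((Jop (fun j => N j * φ j) x).mulVec (Jop (fun j => (ψ j).mulVec (g j)) x)
          - Jop (fun j => (shiftL (Jop fun j => N j * φ j) j).mulVec ((ψ j).mulVec (g j))) x) := by
    rw [← Jop_mulVec_Jop hNφ hψg, ← Jop_sum fun i _ => (hg.Del_iterate i).mulVec _,
      ← Jop_add (SuppBddBelow.sum fun i _ => (hg.Del_iterate i).mulVec _) (hψg.Jop.mulVec _)]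
    simp only [TTop, Matrix.mulVec_add, Matrix.mulVec_sum, Matrix.mulVec_mulVec]
  have hψX : Jop (fun j => (ψ j).mulVec (Xop M N g j)) x
      = (Jop (fun j => ψ j * M j) x).mulVec (Jop (fun j => (N j).mulVec (g j)) x)
        - Jop (fun j => (shiftL (Jop fun j => ψ j * M j) j).mulVec ((N j).mulVec (g j))) x := by
    rw [← Jop_mulVec_Jop hψM hNg]
    simp only [Xop, Matrix.mulVec_mulVec]
  have hstar : Jop (fun y => (LLStarMat n b φ ψ N y).mulVec (g y)) x
      = (∑ i ∈ Finset.range (n + 1), Jop (fun j => (((-1 : R) ^ i) •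
              Del^[i] (shiftLinv^[i] fun j => N j * b i j) j).mulVec (g j)) x)
        + -Jop (fun j => (shiftL (Jop fun j => N j * φ j) j).mulVec ((ψ j).mulVec (g j))) x := by
    rw [← Jop_neg (hψg.mulVec _), ← Jop_sum fun i _ => hg.mulVec _,
      ← Jop_add (SuppBddBelow.sum fun i _ => hg.mulVec _)
        ((hψg.mulVec _).of_imp fun k h => by rw [h, neg_zero])]
    simp only [LLStarMat, Matrix.sum_mulVec, Matrix.mulVec_mulVec,
      sub_eq_add_neg, Matrix.add_mulVec, Matrix.neg_mulVec]
  have hadj : Jop (fun y =>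
        ((fun z => -(shiftL (Jop (fun w => ψ w * M w)) z * N z)) y).mulVec (g y)) x
      = -Jop (fun j => (shiftL (Jop fun j => ψ j * M j) j).mulVec ((N j).mulVec (g j))) x := by
    rw [← Jop_neg (hNg.mulVec _)]
    simp only [Matrix.neg_mulVec, Matrix.mulVec_mulVec]
  rw [hstar, hadj]
  rw [Xop, hXT, TTop, hψX]
  have hX : Xop M N g = fun k => (M k).mulVec (Jop (fun j => (N j).mulVec (g j)) k) := rfl
  rw [hX, LLMat]
  simp only [Matrix.mulVec_add, Matrix.mulVec_sub, Matrix.mulVec_neg, Matrix.add_mulVec,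
    Matrix.mulVec_sum, Matrix.sum_mulVec, Finset.sum_sub_distrib, Matrix.mulVec_mulVec]
  abel
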